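/- arXiv:2206.13257 — 2 statements merged into one kernel-verified Lean document; each statement's English description precedes it below -/
import Mathlib

section
/- Let 0 < η ≤ 1, let k be a natural number with ηk ≥ 4, and set r = 2^{1−ηk/2} (so r ≤ 1/2). Let (F_λ)_{λ≥2} be pairwise disjoint finite sets with |F_λ| ≤ 2^{λ+1}/η for each integer λ ≥ 2, and for each f ∈ F_λ let P_f be a real number with 0 ≤ P_f ≤ 1 and P_f ≤ 2^{−(ηk/2)(λ−1)} · (1 − η/2)^{−k}. Then Σ_{λ=2}^∞ Σ_{f ∈ F_λ} (−P_f · log₂(P_f)) ≤ 2/(e·ln 2) + 2k · (1 − η/2)^{−k} · r/(1−r)² (with the convention −0·log₂(0) = 0). -/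
/-- If `0 ≤ p ≤ b` and `exp (-t) ≤ b` with `1 ≤ t`, then `-p log p ≤ b t`. -/
theorem neg_mul_log_le_mul_of_exp_neg_le {p b t : ℝ} (hp : 0 ≤ p) (hpb : p ≤ b)
    (ht : 1 ≤ t) (hb : Real.exp (-t) ≤ b) : -p * Real.log p ≤ b * t := by
  rcases hp.eq_or_lt with rfl | hp
  · simp only [neg_zero, zero_mul]
    positivity
  · have h := Real.log_le_sub_one_of_pos (div_pos (Real.exp_pos (-t)) hp)
    rw [Real.log_div (Real.exp_pos _).ne' hp.ne', Real.log_exp] at h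
    have h' := mul_le_mul_of_nonneg_left h hp.le
    have e : p * (Real.exp (-t) / p - 1) = Real.exp (-t) - p := by field_simp
    nlinarith [mul_nonneg (sub_nonneg.2 hpb) (sub_nonneg.2 ht)]

/-- If `0 ≤ p ≤ B * 2 ^ (-u)` with `1 ≤ B` and `2 ≤ u`, then
`-p log₂ p ≤ B * 2 ^ (-u) * u`. -/
theorem neg_mul_logb_two_le {p B u : ℝ} (hp : 0 ≤ p) (hB : 1 ≤ B) (hu : 2 ≤ u)
    (hpb : p ≤ (2 : ℝ) ^ (-u) * B) : -p * Real.logb 2 p ≤ (2 : ℝ) ^ (-u) * B * u := by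
  have hlog : 0 < Real.log 2 := Real.log_pos one_lt_two
  have key := neg_mul_log_le_mul_of_exp_neg_le (t := Real.log 2 * u) hp hpb
    (by nlinarith [Real.log_two_gt_d9])
    (by
      rw [← mul_neg, ← Real.rpow_def_of_pos two_pos]
      exact le_mul_of_one_le_right (by positivity) hB)
  rw [Real.logb, ← mul_div_assoc, div_le_iff₀ hlog]
  linarith

/-- **Entropy contribution of rarely-output hypotheses (H₁ bound).** Let `0 < η ≤ 1`,
`ηk ≥ 4`, `r = 2^(1-ηk/2)`. Let `(F_λ)_{λ≥2}` be pairwise disjoint finite sets with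
`|F_λ| ≤ 2^(λ+1)/η`, and for `f ∈ F_λ` let `P f ∈ [0,1]` with
`P f ≤ 2^(-(ηk/2)(λ-1))·(1-η/2)^(-k)`. Then
`Σ_{λ=2}^∞ Σ_{f ∈ F_λ} (-P f · log₂ (P f)) ≤ 2/(e·ln 2) + 2k·(1-η/2)^(-k)·r/(1-r)²`. -/
theorem entropy_H1_bound {H : Type*}
    (η : ℝ) (hη0 : 0 < η) (hη1 : η ≤ 1)
    (k : ℕ) (hk : 4 ≤ η * k)
    (r : ℝ) (hr : r = (2 : ℝ) ^ (1 - η * k / 2))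
    (F : ℕ → Finset H)
    (hdisj : ∀ lam₁ lam₂, 2 ≤ lam₁ → 2 ≤ lam₂ → lam₁ ≠ lam₂ →
      Disjoint (F lam₁) (F lam₂))
    (hcard : ∀ lam, 2 ≤ lam → ((F lam).card : ℝ) ≤ 2 ^ (lam + 1) / η)
    (P : H → ℝ)
    (hP0 : ∀ lam, 2 ≤ lam → ∀ f ∈ F lam, 0 ≤ P f)
    (hP1 : ∀ lam, 2 ≤ lam → ∀ f ∈ F lam, P f ≤ 1)
    (hPB : ∀ lam, 2 ≤ lam → ∀ f ∈ F lam,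
      P f ≤ (2 : ℝ) ^ (-(η * k / 2) * ((lam : ℝ) - 1)) * (1 - η / 2) ^ (-(k : ℝ))) :
    ∑' lam : ℕ, ∑ f ∈ F (lam + 2), (-P f * Real.logb 2 (P f)) ≤
      2 / (Real.exp 1 * Real.log 2) +
        2 * k * (1 - η / 2) ^ (-(k : ℝ)) * r / (1 - r) ^ 2 := by
  have hkpos : (0 : ℝ) ≤ k := k.cast_nonneg
  set B : ℝ := (1 - η / 2) ^ (-(k : ℝ)) with hBdef
  have hB : 1 ≤ B :=
    Real.one_le_rpow_of_pos_of_le_one_of_nonpos (by linarith) (by linarith) (by linarith)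
  have hr0 : 0 < r := hr ▸ by positivity
  have hr1 : r < 1 := hr ▸ Real.rpow_lt_one_of_one_lt_of_neg one_lt_two (by linarith)
  have hgeom : HasSum (fun n : ℕ ↦ 2 * k * B * (((n + 1 : ℕ) : ℝ) * r ^ (n + 1)))
      (2 * k * B * (r / (1 - r) ^ 2)) := by
    refine HasSum.mul_left _ ?_
    have h := hasSum_coe_mul_geometric_of_norm_lt_one (r := r)
      (by rwa [Real.norm_of_nonneg hr0.le])
    simpa using (hasSum_nat_add_iff' 1).2 h
  have hnonneg (n : ℕ) : 0 ≤ ∑ f ∈ F (n + 2), (-P f * Real.logb 2 (P f)) :=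
    Finset.sum_nonneg fun f hf ↦ mul_nonneg_of_nonpos_of_nonpos
      (neg_nonpos.2 (hP0 _ (by omega) f hf))
      (Real.logb_nonpos one_lt_two (hP0 _ (by omega) f hf) (hP1 _ (by omega) f hf))
  have hterm (n : ℕ) : ∑ f ∈ F (n + 2), (-P f * Real.logb 2 (P f)) ≤
      2 * k * B * (((n + 1 : ℕ) : ℝ) * r ^ (n + 1)) := by
    set u : ℝ := η * k / 2 * ((n + 1 : ℕ) : ℝ) with hu
    have hn : (1 : ℝ) ≤ ((n + 1 : ℕ) : ℝ) := by exact_mod_cast Nat.succ_pos n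
    have hu2 : 2 ≤ u := by nlinarith
    have hpow : r ^ (n + 1) = 2 ^ (n + 1) * (2 : ℝ) ^ (-u) := by
      rw [hr, ← Real.rpow_mul_natCast two_pos.le, ← Real.rpow_natCast 2 (n + 1),
        ← Real.rpow_add two_pos]
      congr 1
      rw [hu]
      ring
    calc ∑ f ∈ F (n + 2), (-P f * Real.logb 2 (P f))
        ≤ (F (n + 2)).card • ((2 : ℝ) ^ (-u) * B * u) := by
          refine Finset.sum_le_card_nsmul _ _ _ fun f hf ↦
            neg_mul_logb_two_le (hP0 _ (by omega) f hf) hB hu2 ?_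
          convert hPB _ (by omega) f hf using 3
          rw [hu]
          push_cast
          ring
      _ ≤ 2 ^ (n + 2 + 1) / η * ((2 : ℝ) ^ (-u) * B * u) := by
          rw [nsmul_eq_mul]
          exact mul_le_mul_of_nonneg_right (hcard _ (by omega)) (by positivity)
      _ = 2 * k * B * (((n + 1 : ℕ) : ℝ) * r ^ (n + 1)) := by
          rw [hpow, hu]
          field_simp
          ring
  have hsum := Summable.of_nonneg_of_le hnonneg hterm hgeom.summable
  calc ∑' lam : ℕ, ∑ f ∈ F (lam + 2), (-P f * Real.logb 2 (P f))
      ≤ 2 * k * B * (r / (1 - r) ^ 2) := hasSum_le hterm hsum.hasSum hgeom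
    _ = 2 * k * B * r / (1 - r) ^ 2 := by ring
    _ ≤ _ := le_add_of_nonneg_left (by positivity)
end

section
/- Let X be a measurable space, D a probability measure on X × {0,1}, and h : X → {0,1} a measurable function; write ε = D({(x,y) : h(x) ≠ y}) for the true error of h. Let n ≥ n₁ ≥ 1 be natural numbers, 0 < η ≤ 1, and let E be a measurable subset of (X × {0,1})ⁿ such that D^{⊗n}(E) ≥ η and every ((x₁,y₁),…,(x_n,y_n)) ∈ E satisfies h(x_i) = y_i for all i = 1,…,n₁. Then ε ≤ log₂(1/η)/n₁. -/
open MeasureTheory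

/-- A cylinder over the first `m` coordinates of a finite power of a probability measure. -/
theorem pi_first_coordinates {Z : Type*} [MeasurableSpace Z] (D : Measure Z)
    [IsProbabilityMeasure D] (S : Set Z) {n m : ℕ} (hmn : m ≤ n) :
    Measure.pi (fun _ : Fin n => D) {s | ∀ i : Fin n, (i : ℕ) < m → s i ∈ S} = D S ^ m := by
  have hset : {s : Fin n → Z | ∀ i : Fin n, (i : ℕ) < m → s i ∈ S} =
      Set.univ.pi fun i : Fin n => if (i : ℕ) < m then S else Set.univ := by
    ext s
    simp only [Set.mem_ofPred_eq, Set.mem_univ_pi]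
    refine forall_congr' fun i => ?_
    split_ifs with hi <;> simp [hi]
  have hcard : (Finset.univ.filter fun i : Fin n => (i : ℕ) < m).card = m := by
    rw [Fin.card_filter_val_lt, min_eq_right hmn]
  rw [hset, Measure.pi_pi]
  simp only [apply_ite D, measure_univ]
  rw [Finset.prod_ite, Finset.prod_const, Finset.prod_const_one, mul_one, hcard]

/-- If `η ≤ (1 - ε) ^ m`, then `ε ≤ log₂ (1 / η) / m`. -/
theorem le_logb_div_of_le_one_sub_pow {ε η : ℝ} {m : ℕ} (hm : 1 ≤ m) (hε : ε ≤ 1)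
    (hη0 : 0 < η) (hη1 : η ≤ 1) (h : η ≤ (1 - ε) ^ m) :
    ε ≤ Real.logb 2 (1 / η) / m := by
  have hm0 : (0 : ℝ) < m := by exact_mod_cast hm
  have hexp : η ≤ Real.exp (m * -ε) := by
    rw [Real.exp_nat_mul]
    exact h.trans (pow_le_pow_left₀ (by linarith) (Real.one_sub_le_exp_neg ε) m)
  have hlog : Real.log η ≤ m * -ε := (Real.log_le_iff_le_exp hη0).2 hexp
  have hlogη : Real.log η ≤ 0 := Real.log_nonpos hη0.le hη1
  rw [le_div_iff₀ hm0, Real.logb, one_div, Real.log_inv, le_div_iff₀ (Real.log_pos one_lt_two)]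
  nlinarith [Real.log_two_lt_d9, Real.log_pos one_lt_two]

/-- **Lemma 2.** Let `D` be a probability measure on `X × {0,1}` (labels modelled by
`Bool`), `h : X → Bool` a measurable hypothesis with true error
`ε = D {(x,y) : h x ≠ y}`. If `E ⊆ (X × Bool)ⁿ` is a measurable event of `D^⊗n`-measure
at least `η` on which `h` is consistent with the first `n₁` examples, then
`ε ≤ log₂(1/η) / n₁`. -/
theorem consistent_frequent_hypothesis_error_bound
    {X : Type*} [MeasurableSpace X]
    (D : Measure (X × Bool)) [IsProbabilityMeasure D]
    (h : X → Bool) (hh : Measurable h)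
    (ε : ℝ) (hε : ε = (D {p : X × Bool | h p.1 ≠ p.2}).toReal)
    (n n₁ : ℕ) (hn₁ : 1 ≤ n₁) (hn : n₁ ≤ n)
    (η : ℝ) (hη0 : 0 < η) (hη1 : η ≤ 1)
    (E : Set (Fin n → X × Bool)) (hE : MeasurableSet E)
    (hEη : ENNReal.ofReal η ≤ Measure.pi (fun _ : Fin n => D) E)
    (hcons : ∀ s ∈ E, ∀ i : Fin n, (i : ℕ) < n₁ → h (s i).1 = (s i).2) :
    ε ≤ Real.logb 2 (1 / η) / n₁ := by
  have herr : MeasurableSet {p : X × Bool | h p.1 ≠ p.2} :=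
    (measurableSet_eq_fun (hh.comp measurable_fst) measurable_snd).compl
  have hcompl : {p : X × Bool | h p.1 = p.2} = {p : X × Bool | h p.1 ≠ p.2}ᶜ := by
    ext p
    simp
  have hS : D.real {p : X × Bool | h p.1 = p.2} = 1 - ε := by
    rw [hcompl, probReal_compl_eq_one_sub herr, hε, Measure.real]
  have hε1 : ε ≤ 1 := hε ▸ measureReal_le_one
  have hle : ENNReal.ofReal η ≤ D {p : X × Bool | h p.1 = p.2} ^ n₁ := by
    rw [← pi_first_coordinates D _ hn]
    exact hEη.trans (measure_mono hcons)
  refine le_logb_div_of_le_one_sub_pow hn₁ hε1 hη0 hη1 ?_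
  rw [← hS, Measure.real, ← ENNReal.toReal_pow]
  exact (ENNReal.ofReal_le_iff_le_toReal (by finiteness)).1 hle
end
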